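/- Let m ≥ 2, let V ⊆ ℝ^m be open, and let Γ̂^k_{ij} : V → ℝ be smooth connection coefficients with Γ̂^k_{ij} = Γ̂^k_{ji} (a torsion-free affine connection) whose Ricci curvature vanishes identically on V. Then the Patterson–Walker metric of this connection, the symmetric 2m×2m matrix field g on V × ℝ^m with components g_{x^i x^j} = −2 ∑_k y_k Γ̂^k_{ij}, g_{x^i y_j} = g_{y_j x^i} = δ_{ij}, g_{y_i y_j} = 0, is Ricci-flat: the Ricci curvature of g (computed from its Levi-Civita Christoffel symbols) vanishes identically on V × ℝ^m. -/

import Mathlib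

open scoped BigOperators

/-- Partial derivative of a function on `ι → ℝ` in coordinate direction `i`. -/
noncomputable def pd {ι : Type} [Fintype ι] [DecidableEq ι] (i : ι)
    (f : (ι → ℝ) → ℝ) (x : ι → ℝ) : ℝ :=
  fderiv ℝ f x (Pi.single i 1)

/-- Ricci curvature of an affine connection given by coefficients `Γ k i j`. -/
noncomputable def ricConn {ι : Type} [Fintype ι] [DecidableEq ι]
    (Γ : ι → ι → ι → (ι → ℝ) → ℝ) (i j : ι) (x : ι → ℝ) : ℝ :=
  (∑ k, pd k (fun y => Γ k i j y) x) - (∑ k, pd i (fun y => Γ k k j y) x)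
    + ∑ k, ∑ l, (Γ k k l x * Γ l i j x - Γ k i l x * Γ l k j x)

/-- Levi-Civita Christoffel symbols of a metric in coordinates. -/
noncomputable def christoffel {ι : Type} [Fintype ι] [DecidableEq ι]
    (G : (ι → ℝ) → Matrix ι ι ℝ) (k i j : ι) (x : ι → ℝ) : ℝ :=
  (1/2) * ∑ l, (G x)⁻¹ k l *
    (pd i (fun y => G y j l) x + pd j (fun y => G y i l) x - pd l (fun y => G y i j) x)

/-- Laplacian of a metric in coordinates, applied to a function. -/
noncomputable def laplacian {ι : Type} [Fintype ι] [DecidableEq ι]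
    (G : (ι → ℝ) → Matrix ι ι ℝ) (F : (ι → ℝ) → ℝ) (x : ι → ℝ) : ℝ :=
  ∑ i, ∑ j, (G x)⁻¹ i j *
    (pd i (fun y => pd j F y) x - ∑ k, christoffel G k i j x * pd k F x)

/-- Lie derivative of a metric along a vector field, in coordinates. -/
noncomputable def lieDeriv {ι : Type} [Fintype ι] [DecidableEq ι]
    (X : ι → (ι → ℝ) → ℝ) (G : (ι → ℝ) → Matrix ι ι ℝ) (i j : ι) (x : ι → ℝ) : ℝ :=
  (∑ k, X k x * pd k (fun y => G y i j) x)
  + (∑ k, pd i (X k) x * G x k j) + ∑ k, pd j (X k) x * G x i k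

/-- Index type for the ambient space: `t`, `x^A`, `p_A`, `ρ`. -/
abbrev AmbIdx (n : ℕ) : Type := Unit ⊕ (Fin n ⊕ (Fin n ⊕ Unit))

def it (n : ℕ) : AmbIdx n := Sum.inl ()
def ix {n : ℕ} (A : Fin n) : AmbIdx n := Sum.inr (Sum.inl A)
def ip {n : ℕ} (A : Fin n) : AmbIdx n := Sum.inr (Sum.inr (Sum.inl A))
def irho (n : ℕ) : AmbIdx n := Sum.inr (Sum.inr (Sum.inr ()))

/-- The `x`-coordinates of an ambient point. -/
def xc {n : ℕ} (u : AmbIdx n → ℝ) : Fin n → ℝ := fun A => u (ix A)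

/-- The ambient metric of the affine connection `Γ`. -/
noncomputable def ambientMetric (n : ℕ) (Γ : Fin n → Fin n → Fin n → (Fin n → ℝ) → ℝ)
    (u : AmbIdx n → ℝ) : Matrix (AmbIdx n) (AmbIdx n) ℝ :=
  Matrix.of fun a b =>
    match a, b with
    | Sum.inl _, Sum.inl _ => 2 * u (irho n)
    | Sum.inl _, Sum.inr (Sum.inr (Sum.inr _)) => u (it n)
    | Sum.inr (Sum.inr (Sum.inr _)), Sum.inl _ => u (it n)
    | Sum.inr (Sum.inl A), Sum.inr (Sum.inr (Sum.inl B)) =>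
        (u (it n))^2 * (if A = B then (1:ℝ) else 0)
    | Sum.inr (Sum.inr (Sum.inl A)), Sum.inr (Sum.inl B) =>
        (u (it n))^2 * (if A = B then (1:ℝ) else 0)
    | Sum.inr (Sum.inl A), Sum.inr (Sum.inl B) =>
        (u (it n))^2 * (-2 * ∑ C, u (ip C) * Γ C A B (xc u)
          + (2 * u (irho n) / ((n:ℝ) - 1)) * ricConn Γ A B (xc u))
    | _, _ => 0

/-- The Patterson–Walker metric of a torsion-free affine connection with
coefficients `Γ`, on the doubled space with coordinates `(x, y)`. -/
noncomputable def pwGen {ι : Type} [Fintype ι] [DecidableEq ι]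
    (Γ : ι → ι → ι → (ι → ℝ) → ℝ) (u : (ι ⊕ ι) → ℝ) : Matrix (ι ⊕ ι) (ι ⊕ ι) ℝ :=
  Matrix.of fun a b =>
    match a, b with
    | Sum.inl i, Sum.inl j => -2 * ∑ k, u (Sum.inr k) * Γ k i j (fun l => u (Sum.inl l))
    | Sum.inl i, Sum.inr j => if i = j then (1:ℝ) else 0
    | Sum.inr i, Sum.inl j => if i = j then (1:ℝ) else 0
    | Sum.inr _, Sum.inr _ => 0

/-- `D` preserves a volume form: there is a smooth positive `v` with
`∑_C Γ^C_{AC} = ∂_A (log v)`. -/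
def PreservesVolume (n : ℕ) (Γ : Fin n → Fin n → Fin n → (Fin n → ℝ) → ℝ) : Prop :=
  ∃ v : (Fin n → ℝ) → ℝ, ContDiff ℝ (⊤ : ℕ∞) v ∧ (∀ x, 0 < v x) ∧
    ∀ (A : Fin n) (x : Fin n → ℝ), (∑ C, Γ C A C x) = pd A (fun y => Real.log (v y)) x

/-- Index type for the Thomas cone: `x^0` and `x^A`. -/
abbrev ThIdx (n : ℕ) : Type := Unit ⊕ Fin n

/-- The Thomas cone connection of the affine connection `Γ`. -/
noncomputable def thomasConn (n : ℕ) (Γ : Fin n → Fin n → Fin n → (Fin n → ℝ) → ℝ) :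
    ThIdx n → ThIdx n → ThIdx n → ((ThIdx n) → ℝ) → ℝ := fun c a b u =>
  match c, a, b with
  | Sum.inr C, Sum.inr A, Sum.inr B => Γ C A B (fun E => u (Sum.inr E))
  | Sum.inl _, Sum.inr A, Sum.inr B =>
      -(u (Sum.inl ()) / ((n:ℝ) - 1)) * ricConn Γ A B (fun E => u (Sum.inr E))
  | Sum.inr B, Sum.inr A, Sum.inl _ => if A = B then 1 / u (Sum.inl ()) else 0
  | Sum.inr B, Sum.inl _, Sum.inr A => if A = B then 1 / u (Sum.inl ()) else 0
  | _, _, _ => 0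

section PattersonWalker

variable {ι : Type} [Fintype ι] [DecidableEq ι]

theorem pd_congr_of_eventuallyEq {f g : (ι → ℝ) → ℝ} {x : ι → ℝ}
    (h : f =ᶠ[nhds x] g) (i : ι) : pd i f x = pd i g x := by
  rw [pd, pd, h.fderiv_eq]

theorem pd_const (i : ι) (c : ℝ) (x : ι → ℝ) : pd i (fun _ => c) x = 0 := by
  simp [pd]

theorem pd_neg (i : ι) (f : (ι → ℝ) → ℝ) (x : ι → ℝ) :
    pd i (fun y => -f y) x = -pd i f x := by
  simp [pd]

theorem pd_const_mul {f : (ι → ℝ) → ℝ} {x : ι → ℝ} (hf : DifferentiableAt ℝ f x) (i : ι)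
    (c : ℝ) : pd i (fun y => c * f y) x = c * pd i f x := by
  rw [pd, (hf.hasFDerivAt.const_mul c).fderiv, smul_apply, smul_eq_mul, pd]

theorem differentiableAt_pd {f : (ι → ℝ) → ℝ} {x : ι → ℝ}
    (hf : ContDiffAt ℝ (⊤ : ℕ∞) f x) (i : ι) : DifferentiableAt ℝ (pd i f) x := by
  have h : ContDiffAt ℝ 1 (fderiv ℝ f) x :=
    hf.fderiv_right (m := 1) (by
      rw [one_add_one_eq_two]; exact WithTop.coe_le_coe.mpr le_top)
  exact (h.differentiableAt one_ne_zero).clm_apply (differentiableAt_const _)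

/-- The projection `(x, y) ↦ x` as a continuous linear map. -/
noncomputable def basePoint (ι : Type) : ((ι ⊕ ι) → ℝ) →L[ℝ] (ι → ℝ) :=
  ContinuousLinearMap.pi fun l => ContinuousLinearMap.proj (Sum.inl l)

theorem basePoint_single_inl {ι : Type} [DecidableEq ι] (i : ι) :
    basePoint ι (Pi.single (Sum.inl i) 1) = Pi.single i 1 := by
  ext l
  simp [basePoint, Pi.single_apply]

theorem basePoint_single_inr {ι : Type} [DecidableEq ι] (i : ι) :
    basePoint ι (Pi.single (Sum.inr i) 1) = 0 := by
  ext l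
  simp [basePoint]

theorem hasFDerivAt_comp_basePoint {ι : Type} [Fintype ι] {f : (ι → ℝ) → ℝ} {u : (ι ⊕ ι) → ℝ}
    (hf : DifferentiableAt ℝ f (fun l => u (Sum.inl l))) :
    HasFDerivAt (fun v : (ι ⊕ ι) → ℝ => f (fun l => v (Sum.inl l)))
      ((fderiv ℝ f (fun l => u (Sum.inl l))).comp (basePoint ι)) u :=
  HasFDerivAt.comp u (g := f) (f := basePoint ι) hf.hasFDerivAt (basePoint ι).hasFDerivAt

theorem pd_inl_comp_base {f : (ι → ℝ) → ℝ} {u : (ι ⊕ ι) → ℝ}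
    (hf : DifferentiableAt ℝ f (fun l => u (Sum.inl l))) (i : ι) :
    pd (Sum.inl i) (fun v : (ι ⊕ ι) → ℝ => f (fun l => v (Sum.inl l))) u
      = pd i f (fun l => u (Sum.inl l)) := by
  rw [pd, (hasFDerivAt_comp_basePoint hf).fderiv, ContinuousLinearMap.comp_apply,
    basePoint_single_inl, pd]

theorem pd_inr_comp_base {f : (ι → ℝ) → ℝ} {u : (ι ⊕ ι) → ℝ}
    (hf : DifferentiableAt ℝ f (fun l => u (Sum.inl l))) (i : ι) :
    pd (Sum.inr i) (fun v : (ι ⊕ ι) → ℝ => f (fun l => v (Sum.inl l))) u = 0 := by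
  rw [pd, (hasFDerivAt_comp_basePoint hf).fderiv, ContinuousLinearMap.comp_apply,
    basePoint_single_inr, map_zero]

/-- Derivative of a function that is linear in the fibre coordinates. -/
theorem hasFDerivAt_sum_fibre_mul {ι : Type} [Fintype ι] {c : ι → (ι → ℝ) → ℝ} {u : (ι ⊕ ι) → ℝ}
    (hc : ∀ k, DifferentiableAt ℝ (c k) (fun l => u (Sum.inl l))) :
    HasFDerivAt
      (fun v : (ι ⊕ ι) → ℝ => ∑ k, v (Sum.inr k) * c k (fun l => v (Sum.inl l)))
      (∑ k, (u (Sum.inr k) • (fderiv ℝ (c k) (fun l => u (Sum.inl l))).comp (basePoint ι)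
        + c k (fun l => u (Sum.inl l)) •
          (ContinuousLinearMap.proj (Sum.inr k) : ((ι ⊕ ι) → ℝ) →L[ℝ] ℝ))) u :=
  HasFDerivAt.fun_sum fun k _ =>
    (ContinuousLinearMap.proj (Sum.inr k) : ((ι ⊕ ι) → ℝ) →L[ℝ] ℝ).hasFDerivAt.mul
      (hasFDerivAt_comp_basePoint (hc k))

theorem pd_inl_sum_fibre_mul {c : ι → (ι → ℝ) → ℝ} {u : (ι ⊕ ι) → ℝ}
    (hc : ∀ k, DifferentiableAt ℝ (c k) (fun l => u (Sum.inl l))) (i : ι) :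
    pd (Sum.inl i)
      (fun v : (ι ⊕ ι) → ℝ => ∑ k, v (Sum.inr k) * c k (fun l => v (Sum.inl l))) u
      = ∑ k, u (Sum.inr k) * pd i (c k) (fun l => u (Sum.inl l)) := by
  rw [pd, (hasFDerivAt_sum_fibre_mul hc).fderiv]
  simp [basePoint_single_inl, pd]

theorem pd_inr_sum_fibre_mul {c : ι → (ι → ℝ) → ℝ} {u : (ι ⊕ ι) → ℝ}
    (hc : ∀ k, DifferentiableAt ℝ (c k) (fun l => u (Sum.inl l))) (i : ι) :
    pd (Sum.inr i)
      (fun v : (ι ⊕ ι) → ℝ => ∑ k, v (Sum.inr k) * c k (fun l => v (Sum.inl l))) u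
      = c i (fun l => u (Sum.inl l)) := by
  rw [pd, (hasFDerivAt_sum_fibre_mul hc).fderiv]
  simp [basePoint_single_inr, Pi.single_apply]

variable {Γ : ι → ι → ι → (ι → ℝ) → ℝ}

theorem pwGen_inv (u : (ι ⊕ ι) → ℝ) :
    (pwGen Γ u)⁻¹ = Matrix.fromBlocks 0 1 1
      (-Matrix.of fun i j => -2 * ∑ k, u (Sum.inr k) * Γ k i j (fun l => u (Sum.inl l))) := by
  have h : pwGen Γ u = Matrix.fromBlocks
      (Matrix.of fun i j => -2 * ∑ k, u (Sum.inr k) * Γ k i j (fun l => u (Sum.inl l)))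
      1 1 0 := by
    ext (i | i) (j | j) <;> simp [pwGen, Matrix.one_apply]
  apply Matrix.inv_eq_right_inv
  rw [h, Matrix.fromBlocks_multiply]
  simp [← Matrix.fromBlocks_one]

theorem pwGen_inl_inl (i j : ι) :
    (fun v => pwGen Γ v (Sum.inl i) (Sum.inl j))
      = fun v => ∑ k, v (Sum.inr k) * (-2 * Γ k i j (fun l => v (Sum.inl l))) := by
  ext v
  simp only [pwGen, Matrix.of_apply, Finset.mul_sum]
  exact Finset.sum_congr rfl fun k _ => by ring

theorem pd_inl_pwGen_inl_inl {u : (ι ⊕ ι) → ℝ}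
    (hd : ∀ k i j, DifferentiableAt ℝ (Γ k i j) (fun l => u (Sum.inl l))) (s i j : ι) :
    pd (Sum.inl s) (fun v => pwGen Γ v (Sum.inl i) (Sum.inl j)) u
      = ∑ k, u (Sum.inr k) * (-2 * pd s (Γ k i j) (fun l => u (Sum.inl l))) := by
  rw [pwGen_inl_inl, pd_inl_sum_fibre_mul (c := fun k x => -2 * Γ k i j x)
    (fun k => (hd k i j).const_mul (-2))]
  exact Finset.sum_congr rfl fun k _ => by rw [pd_const_mul (hd k i j)]

theorem pd_inr_pwGen_inl_inl {u : (ι ⊕ ι) → ℝ}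
    (hd : ∀ k i j, DifferentiableAt ℝ (Γ k i j) (fun l => u (Sum.inl l))) (s i j : ι) :
    pd (Sum.inr s) (fun v => pwGen Γ v (Sum.inl i) (Sum.inl j)) u
      = -2 * Γ s i j (fun l => u (Sum.inl l)) := by
  rw [pwGen_inl_inl, pd_inr_sum_fibre_mul (c := fun k x => -2 * Γ k i j x)
    (fun k => (hd k i j).const_mul (-2))]

theorem pd_pwGen_inl_inr (s : ι ⊕ ι) (i j : ι) (u : (ι ⊕ ι) → ℝ) :
    pd s (fun v => pwGen Γ v (Sum.inl i) (Sum.inr j)) u = 0 :=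
  pd_const s _ u

theorem pd_pwGen_inr_inl (s : ι ⊕ ι) (i j : ι) (u : (ι ⊕ ι) → ℝ) :
    pd s (fun v => pwGen Γ v (Sum.inr i) (Sum.inl j)) u = 0 :=
  pd_const s _ u

theorem pd_pwGen_inr_inr (s : ι ⊕ ι) (i j : ι) (u : (ι ⊕ ι) → ℝ) :
    pd s (fun v => pwGen Γ v (Sum.inr i) (Sum.inr j)) u = 0 :=
  pd_const s _ u

/-- The coefficient of `y_l` in the Christoffel symbol with upper index `y_k` and lower indices
`x^i`, `x^j` of the Patterson–Walker metric. -/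
noncomputable def pwFibreCoeff (Γ : ι → ι → ι → (ι → ℝ) → ℝ) (k i j l : ι) (x : ι → ℝ) : ℝ :=
  pd k (Γ l i j) x - pd i (Γ l j k) x - pd j (Γ l i k) x + 2 * ∑ s, Γ l k s x * Γ s i j x

/-- The Christoffel symbols of the Patterson–Walker metric in closed form. -/
noncomputable def pwChristoffel (Γ : ι → ι → ι → (ι → ℝ) → ℝ) (c a b : ι ⊕ ι)
    (u : (ι ⊕ ι) → ℝ) : ℝ :=
  match c, a, b with
  | Sum.inl k, Sum.inl i, Sum.inl j => Γ k i j (fun l => u (Sum.inl l))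
  | Sum.inr k, Sum.inl i, Sum.inl j =>
      ∑ l, u (Sum.inr l) * pwFibreCoeff Γ k i j l (fun l => u (Sum.inl l))
  | Sum.inr k, Sum.inl i, Sum.inr j => -Γ j i k (fun l => u (Sum.inl l))
  | Sum.inr k, Sum.inr i, Sum.inl j => -Γ i j k (fun l => u (Sum.inl l))
  | _, _, _ => 0

theorem christoffel_pwGen {u : (ι ⊕ ι) → ℝ}
    (hd : ∀ k i j, DifferentiableAt ℝ (Γ k i j) (fun l => u (Sum.inl l))) (c a b : ι ⊕ ι) :
    christoffel (pwGen Γ) c a b u = pwChristoffel Γ c a b u := by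
  rcases c with k | k <;> rcases a with i | i <;> rcases b with j | j <;>
    simp only [christoffel, pwGen_inv, Fintype.sum_sum_type, Matrix.fromBlocks_apply₁₁,
      Matrix.fromBlocks_apply₁₂, Matrix.fromBlocks_apply₂₁, Matrix.fromBlocks_apply₂₂,
      Matrix.zero_apply, Matrix.one_apply, Matrix.neg_apply, Matrix.of_apply,
      pd_inl_pwGen_inl_inl hd, pd_inr_pwGen_inl_inl hd, pd_pwGen_inl_inr, pd_pwGen_inr_inl,
      pd_pwGen_inr_inr, pwChristoffel, ite_mul, one_mul, zero_mul, mul_zero, add_zero, zero_add,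
      sub_zero, zero_sub, Finset.sum_ite_eq, Finset.sum_const_zero, Finset.mem_univ,
      if_true]
  · ring
  · have h : ∀ p q r : ι → ℝ, (1 / 2 : ℝ) * (∑ x, p x + ∑ x, q x - ∑ x, r x)
        = ∑ x, (1 / 2) * (p x + q x - r x) := fun p q r => by
      rw [← Finset.sum_add_distrib, ← Finset.sum_sub_distrib, Finset.mul_sum]
    rw [mul_add, h]
    have hquad : (1 / 2 : ℝ) * ∑ s, -(-2 * ∑ l, u (Sum.inr l) * Γ l k s fun l => u (Sum.inl l)) *
          -(-2 * Γ s i j fun l => u (Sum.inl l))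
        = ∑ l, u (Sum.inr l) * (2 * ∑ s, Γ l k s (fun l => u (Sum.inl l)) *
            Γ s i j fun l => u (Sum.inl l)) := by
      simp only [Finset.mul_sum, Finset.sum_mul, ← Finset.sum_neg_distrib]
      rw [Finset.sum_comm]
      exact Finset.sum_congr rfl fun l _ => Finset.sum_congr rfl fun s _ => by ring
    rw [hquad, ← Finset.sum_add_distrib]
    exact Finset.sum_congr rfl fun l _ => by rw [pwFibreCoeff]; ring
  · ring
  · ring

theorem differentiableAt_pwFibreCoeff {x : ι → ℝ}
    (hΓ : ∀ k i j, ContDiffAt ℝ (⊤ : ℕ∞) (Γ k i j) x) (k i j l : ι) :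
    DifferentiableAt ℝ (pwFibreCoeff Γ k i j l) x := by
  have hd : ∀ k i j, DifferentiableAt ℝ (Γ k i j) x := fun k i j =>
    (hΓ k i j).differentiableAt (by simp)
  exact (((differentiableAt_pd (hΓ _ _ _) _).sub (differentiableAt_pd (hΓ _ _ _) _)).sub
    (differentiableAt_pd (hΓ _ _ _) _)).add
    ((DifferentiableAt.fun_sum fun s _ => (hd _ _ _).mul (hd _ _ _)).const_mul 2)

theorem ricConn_congr_of_eventuallyEq {Γ₁ Γ₂ : ι → ι → ι → (ι → ℝ) → ℝ} {x : ι → ℝ}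
    (h : ∀ k i j, Γ₁ k i j =ᶠ[nhds x] Γ₂ k i j) (i j : ι) :
    ricConn Γ₁ i j x = ricConn Γ₂ i j x := by
  simp only [ricConn, fun s k i j => pd_congr_of_eventuallyEq (h k i j) s,
    fun k i j => (h k i j).eq_of_nhds]

theorem ricConn_pwChristoffel {u : (ι ⊕ ι) → ℝ}
    (hΓ : ∀ k i j, ContDiffAt ℝ (⊤ : ℕ∞) (Γ k i j) (fun l => u (Sum.inl l)))
    (hsym : ∀ k i j, Γ k i j =ᶠ[nhds (fun l => u (Sum.inl l))] Γ k j i) (a b : ι ⊕ ι) :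
    ricConn (pwChristoffel Γ) a b u =
      match a, b with
      | Sum.inl i, Sum.inl j =>
          ricConn Γ i j (fun l => u (Sum.inl l)) + ricConn Γ j i (fun l => u (Sum.inl l))
      | _, _ => 0 := by
  have hd : ∀ k i j, DifferentiableAt ℝ (Γ k i j) (fun l => u (Sum.inl l)) := fun k i j =>
    (hΓ k i j).differentiableAt (by simp)
  have hs : ∀ k i j, Γ k i j (fun l => u (Sum.inl l)) = Γ k j i (fun l => u (Sum.inl l)) :=
    fun k i j => (hsym k i j).eq_of_nhds
  have hps : ∀ s k i j, pd s (Γ k i j) (fun l => u (Sum.inl l))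
      = pd s (Γ k j i) (fun l => u (Sum.inl l)) :=
    fun s k i j => pd_congr_of_eventuallyEq (hsym k i j) s
  have hl : ∀ s k i j, pd (Sum.inl s)
      (fun v : (ι ⊕ ι) → ℝ => Γ k i j (fun l => v (Sum.inl l))) u = _ :=
    fun s k i j => pd_inl_comp_base (hd k i j) s
  have hr : ∀ s k i j, pd (Sum.inr s)
      (fun v : (ι ⊕ ι) → ℝ => Γ k i j (fun l => v (Sum.inl l))) u = _ :=
    fun s k i j => pd_inr_comp_base (hd k i j) s
  have hf : ∀ s k i j, pd (Sum.inr s) (fun v : (ι ⊕ ι) → ℝ =>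
      ∑ l, v (Sum.inr l) * pwFibreCoeff Γ k i j l (fun l => v (Sum.inl l))) u = _ :=
    fun s k i j => pd_inr_sum_fibre_mul
      (fun l => differentiableAt_pwFibreCoeff hΓ k i j l) s
  rcases a with i | i <;> rcases b with j | j <;>
    simp only [ricConn, Fintype.sum_sum_type, pwChristoffel, pd_const, pd_neg, hl, hr, hf,
      mul_zero, zero_mul, add_zero, zero_add, sub_self, neg_zero,
      Finset.sum_const_zero, Finset.sum_add_distrib, Finset.sum_sub_distrib]
  set x : ι → ℝ := fun l => u (Sum.inl l)
  have hfibre : ∑ k, pwFibreCoeff Γ k i j k x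
      = ∑ k, pd k (Γ k j i) x - ∑ k, pd i (Γ k k j) x - ∑ k, pd j (Γ k k i) x
        + 2 * ∑ k, ∑ l, Γ k k l x * Γ l i j x := by
    simp only [pwFibreCoeff, Finset.sum_add_distrib, Finset.sum_sub_distrib, Finset.mul_sum,
      fun k => hps k k i j, fun k => hps i k j k, fun k => hps j k i k]
  have htrace : ∑ k, -pd i (Γ k j k) x = -∑ k, pd i (Γ k k j) x := by
    simp only [Finset.sum_neg_distrib, fun k => hps i k j k]
  have hcontract : ∑ k, ∑ l, -Γ k l k x * Γ l i j x = -∑ k, ∑ l, Γ k k l x * Γ l i j x := by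
    simp only [neg_mul, Finset.sum_neg_distrib, fun k l => hs k l k]
  have hswap : ∑ k, ∑ l, Γ k k l x * Γ l j i x = ∑ k, ∑ l, Γ k k l x * Γ l i j x := by
    simp only [fun l => hs l j i]
  have hquad : ∑ k, ∑ l, -Γ l i k x * -Γ k j l x = ∑ k, ∑ l, Γ k j l x * Γ l k i x :=
    Finset.sum_congr rfl fun k _ => Finset.sum_congr rfl fun l _ => by rw [hs l i k]; ring
  rw [hfibre, htrace, hcontract, hswap, hquad]
  ring

end PattersonWalker

/-- The Patterson–Walker metric of a Ricci-flat torsion-free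
affine connection on an open set `V ⊆ ℝ^m` is Ricci-flat on `V × ℝ^m`. -/
theorem pw_metric_ricci_flat_of_ricci_flat_connection
    (m : ℕ) (hm : 2 ≤ m) (V : Set (Fin m → ℝ)) (hV : IsOpen V)
    (Γ : Fin m → Fin m → Fin m → (Fin m → ℝ) → ℝ)
    (hsmooth : ∀ k i j, ContDiffOn ℝ (⊤ : ℕ∞) (Γ k i j) V)
    (hsym : ∀ k i j, ∀ x ∈ V, Γ k i j x = Γ k j i x)
    (hric : ∀ i j, ∀ x ∈ V, ricConn Γ i j x = 0) :
    ∀ u : (Fin m ⊕ Fin m) → ℝ, (fun i => u (Sum.inl i)) ∈ V →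
      ∀ i j : Fin m ⊕ Fin m, ricConn (christoffel (pwGen Γ)) i j u = 0 := by
  intro u hu i j
  have hbase : Continuous fun v : (Fin m ⊕ Fin m) → ℝ => fun l => v (Sum.inl l) := by fun_prop
  have hΓ : ∀ x ∈ V, ∀ k i j, ContDiffAt ℝ (⊤ : ℕ∞) (Γ k i j) x := fun x hx k i j =>
    (hsmooth k i j).contDiffAt (hV.mem_nhds hx)
  have hchr : ∀ c a b, christoffel (pwGen Γ) c a b =ᶠ[nhds u] pwChristoffel Γ c a b :=
    fun c a b => by
      filter_upwards [(hV.preimage hbase).mem_nhds hu] with v hv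
      exact christoffel_pwGen (fun k i j => (hΓ _ hv k i j).differentiableAt (by simp)) c a b
  rw [ricConn_congr_of_eventuallyEq hchr, ricConn_pwChristoffel (hΓ _ hu) fun k i j => by
    filter_upwards [hV.mem_nhds hu] with x hx using hsym k i j x hx]
  rcases i with i | i <;> rcases j with j | j <;> simp [hric _ _ _ hu]
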